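/- Let n ≥ 2 and let w = (w1, …, w_{n−1}) ∈ ℝ^{n−1} be a unit vector such that for every choice of signs ε_i ∈ {−1, +1} one has ε_1 w_1 + ε_2 w_2 + … + ε_{n−1} w_{n−1} ≠ 1. Define v_j = e_j (the j-th standard basis vector of ℝ^n) for 1 ≤ j ≤ n, and v_{n+1} = (0, w_1, …, w_{n−1}) ∈ ℝ^n. Then there is no unit vector ξ ∈ ℝ^n such that ⟨ξ, v_i⟩^2 = ⟨ξ, v_j⟩^2 for all i, j ∈ {1, …, n+1}. -/

import Mathlib

open scoped RealInnerProductSpace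

/-- In any dimension `n ≥ 2`, the `n+1` directions consisting of the standard basis
`e_1, …, e_n` together with `v_{n+1} = (0, w_1, …, w_{n−1})`, where `w` is a unit
vector none of whose signed component sums equals `1`, admit no unit vector `ξ` with
`⟨ξ, v_i⟩² = ⟨ξ, v_j⟩²` for all pairs `i, j`. -/
theorem stmt7 (n : ℕ) (hn : 2 ≤ n) (w : Fin (n - 1) → ℝ)
    (hw : ∑ i, (w i) ^ 2 = 1)
    (hsum : ∀ ε : Fin (n - 1) → ℝ, (∀ i, ε i = 1 ∨ ε i = -1) → ∑ i, ε i * w i ≠ 1)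
    (v : Fin (n + 1) → EuclideanSpace ℝ (Fin n))
    (hv : ∀ j : Fin n, v j.castSucc = EuclideanSpace.single j 1)
    (hvlast : v (Fin.last n) = (WithLp.equiv 2 (Fin n → ℝ)).symm
        (fun i => if h : (i : ℕ) = 0 then 0
          else w ⟨(i : ℕ) - 1, by have := i.isLt; omega⟩)) :
    ¬ ∃ ξ : EuclideanSpace ℝ (Fin n), ‖ξ‖ = 1 ∧
        ∀ i j : Fin (n + 1), ⟪ξ, v i⟫ ^ 2 = ⟪ξ, v j⟫ ^ 2 := by
  rintro ⟨ξ, hξ, h⟩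
  obtain ⟨m, rfl⟩ : ∃ m, n = m + 1 := ⟨n - 1, by omega⟩
  change Fin m → ℝ at w
  have h1 : ∀ j : Fin (m + 1), ⟪ξ, v j.castSucc⟫ = ξ j := by
    intro j
    rw [hv, EuclideanSpace.inner_single_right]
    simp
  have h2 : ⟪ξ, v (Fin.last (m + 1))⟫ = ∑ i : Fin m, ξ i.succ * w i := by
    rw [hvlast, PiLp.inner_apply, Fin.sum_univ_succ]
    simp [mul_comm]
  set S := ∑ i : Fin m, ξ i.succ * w i with hS
  have h3 : ∀ j : Fin (m + 1), ξ j ^ 2 = S ^ 2 := by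
    intro j
    rw [← h1, ← h2]
    exact h _ _
  have hS0 : S ≠ 0 := by
    intro h0
    have : ξ = 0 := by
      ext j
      have := h3 j
      rw [h0] at this
      simpa using this
    rw [this] at hξ
    simp at hξ
  apply hsum (fun i => ξ i.succ / S)
  · intro i
    rcases sq_eq_sq_iff_eq_or_eq_neg.mp (h3 i.succ) with h | h
    · left
      rw [h, div_self hS0]
    · right
      rw [h, neg_div, div_self hS0]
  · have : ∀ i : Fin m, ξ i.succ / S * w i = ξ i.succ * w i / S := fun i => by ring
    show ∑ i : Fin m, ξ i.succ / S * w i = 1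
    simp only [this]
    rw [← Finset.sum_div, ← hS, div_self hS0]
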